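/- There exist real numbers A < B with the following backward-invariance property: every differentiable function y : ℝ → ℝ satisfying y'(s) = f(s)·|g(y(s))| − 1 for all s ≤ s₀ and y(s₀) ∈ [A,B] satisfies y(s) ∈ [A,B] for all s ≤ s₀; in particular any such solution is bounded on (−∞, s₀]. -/

import Mathlib

theorem backward_barrier (s₀ c : ℝ) (y : ℝ → ℝ) (hy : Differentiable ℝ y)
    (h0 : y s₀ ≤ c) (h : ∀ s ≤ s₀, y s = c → 0 < deriv y s) :
    ∀ s ≤ s₀, y s ≤ c := by
  intro s hs
  have hd : ∀ t : ℝ, HasDerivAt (fun t => y (s₀ - t)) (-deriv y (s₀ - t)) t := by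
    intro t
    have h1 := (hy (s₀ - t)).hasDerivAt.comp t ((hasDerivAt_id t).const_sub s₀)
    simpa [Function.comp_def] using h1
  have key := image_le_of_deriv_right_lt_deriv_boundary' (f := fun t => y (s₀ - t))
    (f' := fun t => -deriv y (s₀ - t)) (a := 0) (b := s₀ - s)
    (B := fun _ => c) (B' := fun _ => 0)
    (fun t _ => (hd t).continuousAt.continuousWithinAt)
    (fun t _ => (hd t).hasDerivWithinAt) (by simpa using h0) continuousOn_const
    (fun t _ => hasDerivWithinAt_const _ _ _)
    (fun t ht he => by
      have := h (s₀ - t) (by linarith [ht.1]) he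
      simpa using this)
  have := key (x := s₀ - s) ⟨by linarith, le_refl _⟩
  simpa using this

noncomputable section

open Real

theorem involutoid_ode_bounded_solution
    (s₀ : ℝ) (f g : ℝ → ℝ) (m M : ℝ) (hm : 0 < m) (hM : 0 < M)
    (hf : ∀ s ≤ s₀, m ≤ f s ∧ f s ≤ M)
    (hg0 : g 0 = 0)
    (hgu : ∀ C : ℝ, ∃ y : ℝ, 0 ≤ y ∧ C < |g y|)
    :
    ∃ A B : ℝ, A < B ∧
      ∀ y : ℝ → ℝ, Differentiable ℝ y →
        (∀ s ≤ s₀, deriv y s = f s * |g (y s)| - 1) →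
        y s₀ ∈ Set.Icc A B →
        ∀ s ≤ s₀, y s ∈ Set.Icc A B := by
  obtain ⟨B, hB0, hB⟩ := hgu (1 / m)
  have hB1 : 1 < m * |g B| := by
    rw [div_lt_iff₀ hm] at hB
    linarith
  have hBne : B ≠ 0 := by
    rintro rfl
    rw [hg0] at hB1
    norm_num at hB1
  refine ⟨0, B, lt_of_le_of_ne hB0 hBne.symm, ?_⟩
  intro y hy hode hys s hs
  constructor
  · have := backward_barrier s₀ 0 (fun s => -y s) hy.neg (by simpa using hys.1) (by
      intro t ht he
      have he' : y t = 0 := by simpa using he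
      have h1 := (hy t).hasDerivAt.neg.deriv
      have h2 : deriv (fun s => -y s) t = -deriv y t := h1
      rw [h2, hode t ht, he', hg0]
      norm_num) s hs
    simpa using this
  · refine backward_barrier s₀ B y hy hys.2 ?_ s hs
    intro t ht he
    rw [hode t ht, he]
    have := mul_le_mul_of_nonneg_right (hf t ht).1 (abs_nonneg (g B))
    linarith
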